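/- arXiv:1007.4620 — 2 statements merged into one kernel-verified Lean document; each statement's English description precedes it below -/
import Mathlib

section
/- Let Γ be a finite connected simple graph with vertex set V, |V| ≥ 2, let 𝒯 be a maximal tubing of Γ, and let w be its weight vector. Then w(v) ≥ 0 for every vertex v, and w(v) = 0 if and only if the singleton {v} is a tube of 𝒯. -/
variable {V : Type*} [Fintype V] [DecidableEq V]

/-- A tube of a simple graph: a nonempty proper subset of vertices whose
induced subgraph is connected. -/
def IsTube (G : SimpleGraph V) (T : Finset V) : Prop :=
  T.Nonempty ∧ T ≠ Finset.univ ∧ (G.induce (T : Set V)).Connected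

/-- A tubing: a set of tubes, pairwise either properly nested or disjoint with
no edge between them. -/
def IsTubing (G : SimpleGraph V) (𝒯 : Finset (Finset V)) : Prop :=
  (∀ T ∈ 𝒯, IsTube G T) ∧
  ∀ T ∈ 𝒯, ∀ T' ∈ 𝒯, T ≠ T' →
    T ⊂ T' ∨ T' ⊂ T ∨
      ((∀ v ∈ T, v ∉ T') ∧ ∀ u ∈ T, ∀ v ∈ T', ¬ G.Adj u v)

/-- A maximal tubing: one not properly contained in any other tubing. -/
def IsMaxTubing (G : SimpleGraph V) (𝒯 : Finset (Finset V)) : Prop :=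
  IsTubing G 𝒯 ∧ ∀ 𝒯' : Finset (Finset V), IsTubing G 𝒯' → 𝒯 ⊆ 𝒯' → 𝒯' = 𝒯

/-- `w` is the weight vector of the maximal tubing `𝒯`: for each vertex `v`,
if the minimal element `T` of `𝒯 ∪ {univ}` containing `v` is the singleton
`{v}` then `w v = 0`, and otherwise (`|T| ≥ 2`)
`w v = 3^(|T|-2) - ∑_{v' ∈ T, v' ≠ v} w v'`. -/
def IsWeightVector (𝒯 : Finset (Finset V)) (w : V → ℤ) : Prop :=
  ∀ v : V, ∀ T ∈ insert Finset.univ 𝒯, v ∈ T →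
    (∀ S ∈ insert Finset.univ 𝒯, v ∈ S → T ⊆ S) →
    (T = {v} → w v = 0) ∧
    (2 ≤ T.card → w v = 3 ^ (T.card - 2) - ∑ v' ∈ T.erase v, w v')

/-- Sum of the weights over a tube of size `n`. -/
def tubeSum (n : ℕ) : ℤ := if n ≤ 1 then 0 else 3 ^ (n - 2)

theorem tubeSum_nonneg (n : ℕ) : 0 ≤ tubeSum n := by
  unfold tubeSum; split_ifs <;> positivity

theorem tubeSum_succ_le (n : ℕ) : tubeSum n ≤ tubeSum (n + 1) := by
  unfold tubeSum
  split_ifs with h1 h2 h2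
  · exact le_refl _
  · positivity
  · omega
  · exact pow_le_pow_right₀ (by norm_num) (by omega)

theorem tubeSum_mono : Monotone tubeSum := monotone_nat_of_le_succ tubeSum_succ_le

theorem tubeSum_lt (n : ℕ) (hn : 2 ≤ n) : tubeSum (n - 1) < 3 ^ (n - 2) := by
  unfold tubeSum
  split_ifs with h1
  · positivity
  · exact pow_lt_pow_right₀ (by norm_num) (by omega)

theorem tubeSum_double (n : ℕ) (hn : 1 ≤ n) : 2 * tubeSum n ≤ tubeSum (n + 1) := by
  unfold tubeSum
  split_ifs with h1 h2 h2
  · simp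
  · simp
  · omega
  · have : n + 1 - 2 = (n - 2) + 1 := by omega
    rw [this, pow_succ]
    have : (0 : ℤ) < 3 ^ (n - 2) := by positivity
    linarith

theorem tubeSum_add (a b : ℕ) : tubeSum a + tubeSum b ≤ tubeSum (a + b) := by
  wlog hab : b ≤ a generalizing a b
  · rw [add_comm, add_comm a b]
    exact this b a (by omega)
  rcases Nat.eq_zero_or_pos b with rfl | hb
  · simp [tubeSum]
  have h1 := tubeSum_mono hab
  have h2 := tubeSum_double a (by omega)
  have h3 : tubeSum (a + 1) ≤ tubeSum (a + b) := tubeSum_mono (by omega)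
  linarith

theorem IsTubing.nested {G : SimpleGraph V} {𝒯 : Finset (Finset V)} (h : IsTubing G 𝒯)
    {S T : Finset V} (hS : S ∈ insert Finset.univ 𝒯) (hT : T ∈ insert Finset.univ 𝒯)
    {x : V} (hxS : x ∈ S) (hxT : x ∈ T) :
    S ⊆ T ∨ T ⊆ S := by
  rcases Finset.mem_insert.1 hS with rfl | hS
  · exact Or.inr (Finset.subset_univ _)
  rcases Finset.mem_insert.1 hT with rfl | hT
  · exact Or.inl (Finset.subset_univ _)
  by_cases hST : S = T
  · exact Or.inl hST.subset
  rcases h.2 S hS T hT hST with h1 | h1 | h1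
  · exact Or.inl h1.1
  · exact Or.inr h1.1
  · exact absurd hxT (h1.1 x hxS)

theorem sum_le_tubeSum {G : SimpleGraph V} {𝒯 : Finset (Finset V)} (h : IsTubing G 𝒯)
    {w : V → ℤ} (hw : IsWeightVector 𝒯 w) (n : ℕ) :
    ∀ U : Finset V, U.card = n → (∀ u ∈ U, ∃ S ∈ 𝒯, u ∈ S ∧ S ⊆ U) →
      ∑ u ∈ U, w u ≤ tubeSum U.card := by
  induction n using Nat.strong_induction_on with
  | _ n ih =>
  intro U hUn hU
  by_cases hcov : ∀ u ∈ U, ∃ S ∈ 𝒯, u ∈ S ∧ S ⊂ U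
  · rcases U.eq_empty_or_nonempty with rfl | ⟨u0, hu0⟩
    · simp [tubeSum]
    obtain ⟨S0, hS0, hu0S, hS0U⟩ := hcov u0 hu0
    obtain ⟨S, hS, hmax⟩ := Finset.exists_max_image (𝒯.filter (fun S => S ⊂ U)) Finset.card
      ⟨S0, by simp [hS0, hS0U]⟩
    rw [Finset.mem_filter] at hS
    have hSlt := Finset.card_lt_card hS.2
    have hSne : S.Nonempty := (h.1 S hS.1).1
    have hSpos := hSne.card_pos
    have hcard : (U \ S).card = U.card - S.card := Finset.card_sdiff_of_subset hS.2.1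
    have e1 := ih S.card (by omega) S rfl (fun u hu => ⟨S, hS.1, hu, subset_rfl⟩)
    have e2 := ih (U \ S).card (by omega) (U \ S) rfl (by
      intro u hu
      rw [Finset.mem_sdiff] at hu
      obtain ⟨R, hR, huR, hRU⟩ := hcov u hu.1
      refine ⟨R, hR, huR, ?_⟩
      intro x hx
      refine Finset.mem_sdiff.2 ⟨hRU.1 hx, fun hxS => ?_⟩
      rcases h.nested (Finset.mem_insert_of_mem hR) (Finset.mem_insert_of_mem hS.1) hx hxS
        with h1 | h1
      · exact hu.2 (h1 huR)
      · have h2 := hmax R (by simp [hR, hRU])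
        have h3 := Finset.eq_of_subset_of_card_le h1 h2
        exact hu.2 (h3 ▸ huR))
    have e3 := tubeSum_add (U \ S).card S.card
    have e4 : (U \ S).card + S.card = U.card := by omega
    rw [e4] at e3
    rw [← Finset.sum_sdiff hS.2.1]
    linarith
  · push Not at hcov
    obtain ⟨v, hv, hvm⟩ := hcov
    obtain ⟨S, hS, hvS, hSU⟩ := hU v hv
    have hSeq : S = U := by
      by_contra hne
      exact hvm S hS hvS (hSU.ssubset_of_ne hne)
    subst hSeq
    have hmin : ∀ R ∈ insert Finset.univ 𝒯, v ∈ R → S ⊆ R := by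
      intro R hR hvR
      rcases h.nested (Finset.mem_insert_of_mem hS) hR hvS hvR with h1 | h1
      · exact h1
      · rcases Finset.mem_insert.1 hR with rfl | hR
        · exact Finset.subset_univ _
        · by_contra hn
          exact hvm R hR hvR ⟨h1, hn⟩
    obtain ⟨w0, w1⟩ := hw v S (Finset.mem_insert_of_mem hS) hvS hmin
    by_cases hc : 2 ≤ S.card
    · have := w1 hc
      rw [← Finset.add_sum_erase _ _ hvS, this]
      have : ¬ S.card ≤ 1 := by omega
      simp [tubeSum, this]
    · have : S = {v} := by
        apply Finset.eq_singleton_iff_unique_mem.2 ⟨hvS, fun x hx => ?_⟩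
        exact Finset.card_le_one.1 (by omega) x hx v hvS
      have hw0 := w0 this
      rw [this]
      simp [hw0, tubeSum]

/-- Two vertices cannot have the same minimal element in a maximal tubing. -/
theorem exists_smaller {G : SimpleGraph V} {𝒯 : Finset (Finset V)} (h : IsMaxTubing G 𝒯)
    {T : Finset V} (hT : T ∈ insert Finset.univ 𝒯) {u v : V} (hu : u ∈ T) (hv : v ∈ T)
    (huv : u ≠ v) (hmin : ∀ S ∈ insert Finset.univ 𝒯, v ∈ S → T ⊆ S) :
    ∃ S ∈ 𝒯, u ∈ S ∧ S ⊆ T.erase v := by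
  classical
  by_contra hno
  push Not at hno
  obtain ⟨C, hC, hmax⟩ := Finset.exists_max_image
    ((T.erase v).powerset.filter (fun C : Finset V => u ∈ C ∧ (G.induce (C : Set V)).Connected))
    Finset.card ⟨{u}, by
      simp only [Finset.mem_filter, Finset.mem_powerset, Finset.singleton_subset_iff,
        Finset.mem_erase, Finset.mem_singleton, true_and]
      refine ⟨⟨huv, hu⟩, ?_⟩
      rw [Finset.coe_singleton]
      exact ⟨SimpleGraph.Preconnected.of_subsingleton⟩⟩
  simp only [Finset.mem_filter, Finset.mem_powerset] at hC hmax
  obtain ⟨hCT, huC, hCc⟩ := hC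
  have hvC : v ∉ C := fun hvC => by simpa using hCT hvC
  have hext : ∀ D : Finset V, D ⊆ T.erase v → C ⊆ D → (G.induce (D : Set V)).Connected →
      D ⊆ C := by
    intro D hD hCD hDc
    exact (Finset.eq_of_subset_of_card_le hCD (hmax D ⟨hD, hCD huC, hDc⟩)).symm.subset
  have key : ∀ S ∈ 𝒯, S ≠ C → S ⊂ C ∨ C ⊂ S ∨
      ((∀ x ∈ S, x ∉ C) ∧ ∀ x ∈ S, ∀ y ∈ C, ¬ G.Adj x y) := by
    intro S hS hSC
    by_cases hTS : T ⊆ S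
    · refine Or.inr (Or.inl ⟨fun x hx => hTS (Finset.mem_of_mem_erase (hCT hx)), ?_⟩)
      intro h1
      exact hvC (h1 (hTS hv))
    by_cases hST : S ⊆ T
    · have hvS : v ∉ S := fun hvS => hTS (hmin S (Finset.mem_insert_of_mem hS) hvS)
      have hSv : S ⊆ T.erase v := fun x hx =>
        Finset.mem_erase.2 ⟨fun e => hvS (e ▸ hx), hST hx⟩
      have hSc := (h.1.1 S hS).2.2
      by_cases hsub : S ⊆ C
      · exact Or.inl (hsub.ssubset_of_ne hSC)
      refine Or.inr (Or.inr ⟨fun x hxS hxC => ?_, fun x hxS y hyC hadj => ?_⟩)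
      · apply hsub
        refine Finset.Subset.trans Finset.subset_union_right
          (hext (C ∪ S) (Finset.union_subset hCT hSv) Finset.subset_union_left ?_)
        rw [Finset.coe_union]
        exact SimpleGraph.induce_union_connected hCc.preconnected hSc.preconnected ⟨x, hxC, hxS⟩
      · apply hsub
        refine Finset.Subset.trans Finset.subset_union_right
          (hext (C ∪ S) (Finset.union_subset hCT hSv) Finset.subset_union_left ?_)
        have h1 := SimpleGraph.induce_union_connected hCc.preconnected
          (SimpleGraph.induce_pair_connected_of_adj hadj).preconnected ⟨y, hyC, by simp⟩
        have h2 := SimpleGraph.induce_union_connected h1.preconnected hSc.preconnected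
          ⟨x, by simp, hxS⟩
        have h3 : ((C ∪ S : Finset V) : Set V) = (C : Set V) ∪ {x, y} ∪ (S : Set V) := by
          ext z
          simp only [Finset.coe_union, Set.mem_union, Finset.mem_coe, Set.mem_insert_iff,
            Set.mem_singleton_iff]
          constructor
          · tauto
          · rintro ((h | rfl | rfl) | h)
            · exact Or.inl h
            · exact Or.inr hxS
            · exact Or.inl hyC
            · exact Or.inr h
        rw [h3]
        exact h2
    · rcases Finset.mem_insert.1 hT with rfl | hT
      · exact absurd (Finset.subset_univ _) hST
      rcases h.1.2 S hS T hT (fun e => hST e.subset) with h1 | h1 | h1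
      · exact absurd h1.1 hST
      · exact absurd h1.1 hTS
      · exact Or.inr (Or.inr ⟨fun x hx hxC => h1.1 x hx (Finset.mem_of_mem_erase (hCT hxC)),
          fun x hx y hy => h1.2 x hx y (Finset.mem_of_mem_erase (hCT hy))⟩)
  have htub : IsTubing G (insert C 𝒯) := by
    refine ⟨?_, ?_⟩
    · intro S hS
      rcases Finset.mem_insert.1 hS with rfl | hS
      · exact ⟨⟨u, huC⟩, fun e => hvC (e ▸ Finset.mem_univ v), hCc⟩
      · exact h.1.1 S hS
    · intro S hS R hR hne
      rcases Finset.mem_insert.1 hS with rfl | hS2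
      · rcases Finset.mem_insert.1 hR with rfl | hR
        · exact absurd rfl hne
        · rcases key R hR hne.symm with h1 | h1 | h1
          · exact Or.inr (Or.inl h1)
          · exact Or.inl h1
          · exact Or.inr (Or.inr ⟨fun x hx hxR => h1.1 x hxR hx,
              fun x hx y hy hadj => h1.2 y hy x hx hadj.symm⟩)
      · rcases Finset.mem_insert.1 hR with rfl | hR
        · exact key S hS2 hne
        · exact h.1.2 S hS2 R hR hne
  have hCmem : C ∈ 𝒯 := by
    rw [← h.2 _ htub (Finset.subset_insert _ _)]
    exact Finset.mem_insert_self _ _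
  exact hno C hCmem huC hCT

theorem weight_nonneg_and_zero_iff_singleton
    (G : SimpleGraph V) (hG : G.Connected) (hV : 2 ≤ Fintype.card V)
    (𝒯 : Finset (Finset V)) (h : IsMaxTubing G 𝒯)
    (w : V → ℤ) (hw : IsWeightVector 𝒯 w) :
    ∀ v : V, 0 ≤ w v ∧ (w v = 0 ↔ {v} ∈ 𝒯) := by
  intro v
  obtain ⟨T, hT, hTmin⟩ := Finset.exists_min_image
    ((insert Finset.univ 𝒯).filter (fun S => v ∈ S)) Finset.card ⟨Finset.univ, by simp⟩
  rw [Finset.mem_filter] at hT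
  obtain ⟨hT, hvT⟩ := hT
  have hmin : ∀ S ∈ insert Finset.univ 𝒯, v ∈ S → T ⊆ S := by
    intro S hS hvS
    rcases h.1.nested hT hS hvT hvS with h1 | h1
    · exact h1
    · exact (Finset.eq_of_subset_of_card_le h1
        (hTmin S (Finset.mem_filter.2 ⟨hS, hvS⟩))).symm.subset
  obtain ⟨w0, w1⟩ := hw v T hT hvT hmin
  by_cases hc : 2 ≤ T.card
  · have e1 := sum_le_tubeSum h.1 hw _ (T.erase v) rfl (by
      intro u hu
      rw [Finset.mem_erase] at hu
      exact exists_smaller h hT hu.2 hvT hu.1 hmin)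
    rw [Finset.card_erase_of_mem hvT] at e1
    have e2 := tubeSum_lt T.card hc
    have e3 := w1 hc
    have hpos : 0 < w v := by linarith
    refine ⟨hpos.le, fun e => absurd e hpos.ne', fun hs => ?_⟩
    have := Finset.card_le_card
      (hmin {v} (Finset.mem_insert_of_mem hs) (Finset.mem_singleton_self v))
    rw [Finset.card_singleton] at this
    omega
  · have hTv : T = {v} := by
      apply Finset.eq_singleton_iff_unique_mem.2 ⟨hvT, fun x hx => ?_⟩
      exact Finset.card_le_one.1 (by omega) x hx v hvT
    have hw0 := w0 hTv
    refine ⟨hw0.ge, fun _ => ?_, fun _ => hw0⟩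
    rcases Finset.mem_insert.1 hT with e | hT
    · rw [e, Finset.card_univ] at hc
      omega
    · exact hTv ▸ hT
end

section
/- Let Γ be a finite connected simple graph with vertex set V, and let 𝒯 and 𝒯̃ be adjacent maximal tubings of Γ, i.e., there are tubes T₁ ∈ 𝒯 and T₁' ∈ 𝒯̃ with T₁ ≠ T₁' such that 𝒯 \ {T₁} = 𝒯̃ \ {T₁'}. Let w and w̃ be the weight vectors of 𝒯 and 𝒯̃. Then there exists an integer m ≥ 1 such that, as functions V → ℤ, w̃ − w = m · (1_{v_{T₁}} − 1_{v_{σ(T₁)}}), where v_{T₁} is the unique vertex of T₁ not contained in any element of 𝒯 properly contained in T₁, and σ(T₁) is the minimal element of 𝒯 ∪ {V} properly containing T₁. -/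
variable {V : Type*} [Fintype V] [DecidableEq V]

/-- The indicator function of a vertex, with values in `ℤ`. -/
def indic (a u : V) : ℤ := if u = a then 1 else 0

theorem aux_edge (G : SimpleGraph V) (T S : Finset V)
    (hT : (G.induce (T : Set V)).Connected) (hS : S.Nonempty) (hST : S ⊂ T) :
    ∃ x ∈ S, ∃ y ∈ T, y ∉ S ∧ G.Adj x y := by
  obtain ⟨a, ha⟩ := hS
  obtain ⟨b, hbT, hbS⟩ := Finset.exists_of_ssubset hST
  obtain ⟨p⟩ := hT.preconnected ⟨a, hST.1 ha⟩ ⟨b, hbT⟩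
  obtain ⟨d, -, h1, h2⟩ := p.exists_boundary_dart {x | x.1 ∈ S} ha hbS
  exact ⟨d.fst.1, h1, d.snd.1, d.snd.2, h2, d.adj⟩

theorem aux_conn (G : SimpleGraph V) (hG : G.Connected) (𝒯 : Finset (Finset V))
    (h : IsTubing G 𝒯) (T : Finset V) (hT : T ∈ insert Finset.univ 𝒯) :
    (G.induce (T : Set V)).Connected := by
  rcases Finset.mem_insert.1 hT with rfl | hT
  · rw [Finset.coe_univ]
    exact (SimpleGraph.induceUnivIso G).connected_iff.2 hG
  · exact (h.1 T hT).2.2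

theorem aux_compat (G : SimpleGraph V) (𝒯 : Finset (Finset V))
    (h : IsTubing G 𝒯) (S T : Finset V) (hS : S ∈ insert Finset.univ 𝒯)
    (hT : T ∈ insert Finset.univ 𝒯) :
    S = T ∨ S ⊂ T ∨ T ⊂ S ∨
      ((∀ v ∈ S, v ∉ T) ∧ ∀ u ∈ S, ∀ v ∈ T, ¬ G.Adj u v) := by
  by_cases hST : S = T
  · exact Or.inl hST
  right
  rcases Finset.mem_insert.1 hT with rfl | hT
  · left
    exact Finset.ssubset_univ_iff.2 hST
  rcases Finset.mem_insert.1 hS with rfl | hS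
  · right; left
    exact Finset.ssubset_univ_iff.2 (Ne.symm hST)
  exact h.2 S hS T hT hST

/-- existence of top vertex -/
theorem aux_top (G : SimpleGraph V) (hG : G.Connected) (𝒯 : Finset (Finset V))
    (h : IsTubing G 𝒯) (T : Finset V) (hT : T ∈ insert Finset.univ 𝒯) :
    ∃ v ∈ T, ∀ S ∈ 𝒯, S ⊂ T → v ∉ S := by
  by_contra hcon
  push Not at hcon
  have hc := aux_conn G hG 𝒯 h T hT
  obtain ⟨⟨a, ha⟩⟩ := hc.nonempty
  obtain ⟨S0, hS0, hS0T, haS0⟩ := hcon a ha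
  obtain ⟨S, hS, hmax⟩ := Finset.exists_max_image (𝒯.filter (· ⊂ T)) Finset.card
    ⟨S0, by simp [hS0, hS0T]⟩
  rw [Finset.mem_filter] at hS
  obtain ⟨x, hx, y, hy, hyS, hxy⟩ := aux_edge G T S hc (h.1 S hS.1).1 hS.2
  obtain ⟨S', hS', hS'T, hyS'⟩ := hcon y hy
  rcases aux_compat G 𝒯 h S S' (Finset.mem_insert_of_mem hS.1) (Finset.mem_insert_of_mem hS') with
    h1 | h1 | h1 | h1
  · exact hyS (h1 ▸ hyS')
  · have := hmax S' (by simp [hS', hS'T])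
    have := Finset.card_lt_card h1
    omega
  · exact hyS (h1.1 hyS')
  · exact h1.2 x hx y hyS' hxy

/-- the component of `u` in `T` minus `v` -/
theorem aux_comp (G : SimpleGraph V) (T : Finset V) (u v : V) (hu : u ∈ T) (hv : v ∈ T)
    (huv : u ≠ v) :
    ∃ C : Finset V, u ∈ C ∧ C ⊂ T ∧ v ∉ C ∧ ∀ 𝒯, IsMaxTubing G 𝒯 →
      T ∈ insert Finset.univ 𝒯 → (∀ S ∈ 𝒯, S ⊂ T → v ∉ S) → C ∈ 𝒯 := by
  classical
  obtain ⟨C, hC, hmax⟩ := Finset.exists_max_image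
    ((T.erase v).powerset.filter
      (fun C : Finset V => u ∈ C ∧ (G.induce (C : Set V)).Connected)) Finset.card
    ⟨{u}, by
      simp only [Finset.mem_filter, Finset.mem_powerset, Finset.singleton_subset_iff,
        Finset.mem_erase, Finset.mem_singleton, true_and]
      refine ⟨⟨huv, hu⟩, ?_⟩
      rw [Finset.coe_singleton]
      exact ⟨SimpleGraph.Preconnected.of_subsingleton⟩⟩
  simp only [Finset.mem_filter, Finset.mem_powerset] at hC hmax
  obtain ⟨hCT, huC, hCc⟩ := hC
  have hvC : v ∉ C := fun hh => (Finset.mem_erase.1 (hCT hh)).1 rfl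
  have hCT' : C ⊂ T := by
    refine ⟨fun x hx => Finset.mem_of_mem_erase (hCT hx), fun hh => hvC (hh hv)⟩
  have key : ∀ S : Finset V, S ⊆ T.erase v → (G.induce ((C ∪ S : Finset V) : Set V)).Connected →
      S ⊆ C := by
    intro S hS hcon
    have h1 := hmax (C ∪ S) ⟨Finset.union_subset hCT hS, Finset.mem_union_left _ huC, hcon⟩
    have h2 := Finset.eq_of_subset_of_card_le (Finset.subset_union_left (s₁ := C) (s₂ := S)) h1
    rw [h2]
    exact Finset.subset_union_right
  refine ⟨C, huC, hCT', hvC, ?_⟩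
  intro 𝒯 hmx hT htop
  have hcp : ∀ S ∈ 𝒯, C ≠ S → C ⊂ S ∨ S ⊂ C ∨
      ((∀ v ∈ C, v ∉ S) ∧ ∀ u ∈ C, ∀ v ∈ S, ¬ G.Adj u v) := by
    intro S hS hne
    rcases aux_compat G 𝒯 hmx.1 S T (Finset.mem_insert_of_mem hS) hT with h1 | h1 | h1 | h1
    · left; rw [h1]; exact hCT'
    · right
      have hSe : S ⊆ T.erase v := fun x hx => Finset.mem_erase.2
        ⟨fun hh => htop S hS h1 (hh ▸ hx), h1.1 hx⟩
      have hSc := (hmx.1.1 S hS).2.2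
      by_cases hsub : S ⊆ C
      · left; exact lt_of_le_of_ne hsub (Ne.symm hne)
      · right
        constructor
        · intro x hx hxS
          apply hsub
          apply key S hSe
          rw [Finset.coe_union]
          exact SimpleGraph.induce_union_connected hCc.preconnected hSc.preconnected ⟨x, hx, hxS⟩
        · intro x hx y hy hxy
          apply hsub
          apply key S hSe
          rw [Finset.coe_union]
          exact SimpleGraph.connected_induce_union hCc.preconnected hSc.preconnected hx hy hxy
    · left; exact hCT'.trans h1
    · right; right
      exact ⟨fun x hx hxS => h1.1 x hxS (hCT'.1 hx),
        fun x hx y hy hxy => h1.2 y hy x (hCT'.1 hx) hxy.symm⟩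
  have htub : IsTubing G (insert C 𝒯) := by
    constructor
    · intro S hS
      rcases Finset.mem_insert.1 hS with rfl | hS
      · refine ⟨⟨u, huC⟩, ?_, hCc⟩
        intro hh
        exact hvC (hh ▸ Finset.mem_univ v)
      · exact hmx.1.1 S hS
    · intro S hS S' hS' hne
      rcases Finset.mem_insert.1 hS with rfl | hR
      · rcases Finset.mem_insert.1 hS' with rfl | hR'
        · exact absurd rfl hne
        · exact hcp S' hR' hne
      · rcases Finset.mem_insert.1 hS' with rfl | hR'
        · rcases hcp S hR (Ne.symm hne) with h1 | h1 | h1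
          · exact Or.inr (Or.inl h1)
          · exact Or.inl h1
          · exact Or.inr (Or.inr ⟨fun x hx hx' => h1.1 x hx' hx,
              fun x hx y hy hxy => h1.2 y hy x hx hxy.symm⟩)
        · exact hmx.1.2 S hR S' hR' hne
  have := hmx.2 _ htub (Finset.subset_insert _ _)
  rw [← this]
  exact Finset.mem_insert_self _ _

theorem aux_unique (G : SimpleGraph V) (𝒯 : Finset (Finset V))
    (h : IsMaxTubing G 𝒯) (T : Finset V) (hT : T ∈ insert Finset.univ 𝒯) (u v : V)
    (hu : u ∈ T) (hv : v ∈ T) (hu' : ∀ S ∈ 𝒯, S ⊂ T → u ∉ S)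
    (hv' : ∀ S ∈ 𝒯, S ⊂ T → v ∉ S) : u = v := by
  by_contra hne
  obtain ⟨C, huC, hCT, -, hC⟩ := aux_comp G T u v hu hv hne
  exact hu' C (hC 𝒯 h hT hv') hCT huC

def wtf (n : ℕ) : ℤ := if n ≤ 1 then 0 else 3 ^ (n - 2)

theorem wtf_nonneg (n : ℕ) : 0 ≤ wtf n := by
  unfold wtf; split_ifs <;> positivity

theorem wtf_lt (a b n : ℕ) (ha : a < n) (hb : b < n) (hn : 2 ≤ n) :
    wtf a + wtf b + 1 ≤ wtf n := by
  obtain ⟨k, rfl⟩ := Nat.exists_eq_add_of_le hn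
  have hk : wtf (2 + k) = 3 ^ k := by
    unfold wtf; rw [if_neg (by omega)]; congr 1; omega
  have key : ∀ a, a < 2 + k → 3 * wtf a ≤ 3 ^ k := by
    intro a ha
    unfold wtf
    split_ifs with h1
    · simp
    · rw [← pow_succ']
      exact pow_le_pow_right₀ (by norm_num) (by omega)
  have h1 := key a ha
  have h2 := key b hb
  have h3 : (1 : ℤ) ≤ 3 ^ k := one_le_pow₀ (by norm_num)
  have h4 := wtf_nonneg a
  have h5 := wtf_nonneg b
  rw [hk]
  omega

theorem aux_sum (G : SimpleGraph V) (hG : G.Connected) (𝒯 : Finset (Finset V))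
    (h : IsTubing G 𝒯) (w : V → ℤ) (hw : IsWeightVector 𝒯 w)
    (T : Finset V) (hT : T ∈ insert Finset.univ 𝒯) :
    ∑ x ∈ T, w x = wtf T.card := by
  obtain ⟨v, hv, htop⟩ := aux_top G hG 𝒯 h T hT
  obtain ⟨h0, h2⟩ := hw v T hT hv (by
    intro S hS hvS
    rcases aux_compat G 𝒯 h S T hS hT with h1 | h1 | h1 | h1
    · exact h1.symm.subset
    · exfalso
      rcases Finset.mem_insert.1 hS with rfl | hS
      · exact h1.2 (Finset.subset_univ _)
      · exact htop S hS h1 hvS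
    · exact h1.1
    · exact absurd hv (h1.1 v hvS))
  by_cases hc : T.card ≤ 1
  · have : T = {v} := Finset.eq_singleton_iff_unique_mem.2
      ⟨hv, fun x hx => Finset.card_le_one.1 hc x hx v hv⟩
    have h0 := h0 this
    rw [this]
    simp [h0, wtf]
  · have h2 := h2 (by omega)
    rw [← Finset.add_sum_erase T w hv, h2]
    simp [wtf, hc]

theorem aux_nonneg (G : SimpleGraph V) (hG : G.Connected) (𝒯 : Finset (Finset V))
    (h : IsTubing G 𝒯) (w : V → ℤ) (hw : IsWeightVector 𝒯 w) (n : ℕ) :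
    ∀ X : Finset V, X.card ≤ n → (∀ x ∈ X, ∃ S ∈ 𝒯, x ∈ S ∧ S ⊆ X) → 0 ≤ ∑ x ∈ X, w x := by
  induction n with
  | zero =>
    intro X hX _
    rw [Finset.card_eq_zero.1 (Nat.le_zero.1 hX)]
    simp
  | succ n ih =>
    intro X hX hcov
    rcases X.eq_empty_or_nonempty with rfl | ⟨a, ha⟩
    · simp
    obtain ⟨S0, hS0, -, hS0X⟩ := hcov a ha
    obtain ⟨S, hS, hmax⟩ := Finset.exists_max_image (𝒯.filter (· ⊆ X)) Finset.card
      ⟨S0, by simp [hS0, hS0X]⟩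
    rw [Finset.mem_filter] at hS
    rw [← Finset.sum_sdiff hS.2, aux_sum G hG 𝒯 h w hw S (Finset.mem_insert_of_mem hS.1)]
    have hpos : 0 < S.card := Finset.card_pos.2 (h.1 S hS.1).1
    have hcard := Finset.card_sdiff_add_card_eq_card hS.2
    have := ih (X \ S) (by omega) (by
      intro x hx
      rw [Finset.mem_sdiff] at hx
      obtain ⟨S', hS', hxS', hS'X⟩ := hcov x hx.1
      refine ⟨S', hS', hxS', fun y hy => Finset.mem_sdiff.2 ⟨hS'X hy, fun hyS => ?_⟩⟩
      rcases aux_compat G 𝒯 h S S' (Finset.mem_insert_of_mem hS.1)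
        (Finset.mem_insert_of_mem hS') with h1 | h1 | h1 | h1
      · exact hx.2 (h1 ▸ hxS')
      · have := hmax S' (by simp [hS', hS'X])
        have := Finset.card_lt_card h1
        omega
      · exact hx.2 (h1.1 hxS')
      · exact h1.1 y hyS hy)
    have := wtf_nonneg S.card
    omega

theorem adjacent_tubings_weight_difference
    (G : SimpleGraph V) (hG : G.Connected)
    (𝒯 𝒯' : Finset (Finset V)) (h : IsMaxTubing G 𝒯) (h' : IsMaxTubing G 𝒯')
    (w w' : V → ℤ) (hw : IsWeightVector 𝒯 w) (hw' : IsWeightVector 𝒯' w')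
    -- adjacency of the two maximal tubings:
    (T₁ T₁' : Finset V) (hT₁ : T₁ ∈ 𝒯) (hT₁' : T₁' ∈ 𝒯') (hne : T₁ ≠ T₁')
    (hadj : 𝒯.erase T₁ = 𝒯'.erase T₁')
    -- `v_{T₁}`, the unique vertex of `T₁` not in any tube properly inside `T₁`:
    (v₁ : V) (hv₁ : v₁ ∈ T₁ ∧ ∀ S ∈ 𝒯, S ⊂ T₁ → v₁ ∉ S)
    -- `σ(T₁)`, the smallest element of `𝒯 ∪ {univ}` properly containing `T₁`:
    (σT₁ : Finset V)
    (hσT₁ : σT₁ ∈ insert Finset.univ 𝒯 ∧ T₁ ⊂ σT₁ ∧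
      ∀ S ∈ insert Finset.univ 𝒯, T₁ ⊂ S → σT₁ ⊆ S)
    -- `v_{σ(T₁)}`:
    (vσ : V) (hvσ : vσ ∈ σT₁ ∧ ∀ S ∈ 𝒯, S ⊂ σT₁ → vσ ∉ S) :
    ∃ m : ℤ, 1 ≤ m ∧
      ∀ u : V, w' u - w u = m * (indic v₁ u - indic vσ u) := by
  obtain ⟨hv₁T, hv₁top⟩ := hv₁
  obtain ⟨hσ, hTσ, hσmin⟩ := hσT₁
  obtain ⟨hvσσ, hvσtop⟩ := hvσ
  have hv₁σ : v₁ ∈ σT₁ := hTσ.1 hv₁T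
  have hvσT₁ : vσ ∉ T₁ := hvσtop T₁ hT₁ hTσ
  have hne_v : v₁ ≠ vσ := fun hh => hvσT₁ (hh ▸ hv₁T)
  have hto' : ∀ S ∈ 𝒯, S ≠ T₁ → S ∈ 𝒯' := fun S hS hn =>
    Finset.mem_of_mem_erase (hadj ▸ Finset.mem_erase.2 ⟨hn, hS⟩ : S ∈ 𝒯'.erase T₁')
  have hfrom' : ∀ S ∈ 𝒯', S ≠ T₁' → S ∈ 𝒯 ∧ S ≠ T₁ := fun S hS hn =>
    (Finset.mem_erase.1 (hadj.symm ▸ Finset.mem_erase.2 ⟨hn, hS⟩ : S ∈ 𝒯.erase T₁)).symm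
  have hto'u : ∀ S ∈ insert Finset.univ 𝒯, S ≠ T₁ → S ∈ insert Finset.univ 𝒯' := by
    intro S hS hn
    rcases Finset.mem_insert.1 hS with rfl | hS
    · exact Finset.mem_insert_self _ _
    · exact Finset.mem_insert_of_mem (hto' S hS hn)
  have hσ' : σT₁ ∈ insert Finset.univ 𝒯' := hto'u σT₁ hσ hTσ.ne'
  have hb1 : ∀ S ∈ insert Finset.univ 𝒯, S ≠ T₁ → v₁ ∈ S → σT₁ ⊆ S := by
    intro S hS hn hv
    rcases aux_compat G 𝒯 h.1 S T₁ hS (Finset.mem_insert_of_mem hT₁) with h1 | h1 | h1 | h1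
    · exact absurd h1 hn
    · rcases Finset.mem_insert.1 hS with rfl | hS
      · exact absurd (Finset.subset_univ _) h1.2
      · exact absurd hv (hv₁top S hS h1)
    · exact hσmin S hS h1
    · exact absurd hv₁T (h1.1 v₁ hv)
  have hb2 : ∀ S ∈ insert Finset.univ 𝒯, vσ ∈ S → σT₁ ⊆ S := by
    intro S hS hv
    rcases aux_compat G 𝒯 h.1 S σT₁ hS hσ with h1 | h1 | h1 | h1
    · exact h1.symm.subset
    · rcases Finset.mem_insert.1 hS with rfl | hS
      · exact absurd (Finset.subset_univ _) h1.2
      · exact absurd hv (hvσtop S hS h1)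
    · exact h1.1
    · exact absurd hvσσ (h1.1 vσ hv)
  have hT'σ : T₁' ⊂ σT₁ := by
    by_contra hcon
    apply hne_v
    apply aux_unique G 𝒯' h' σT₁ hσ' v₁ vσ hv₁σ hvσσ
    · intro S hS hSσ hv
      have hn : S ≠ T₁' := fun hh => hcon (hh ▸ hSσ)
      obtain ⟨hS1, hS2⟩ := hfrom' S hS hn
      exact hSσ.2 (hb1 S (Finset.mem_insert_of_mem hS1) hS2 hv)
    · intro S hS hSσ hv
      have hn : S ≠ T₁' := fun hh => hcon (hh ▸ hSσ)
      obtain ⟨hS1, hS2⟩ := hfrom' S hS hn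
      exact hSσ.2 (hb2 S (Finset.mem_insert_of_mem hS1) hv)
  have hT₁sub : ∀ x ∈ T₁, x ≠ v₁ → ∃ S ∈ 𝒯, S ⊂ T₁ ∧ x ∈ S := by
    intro x hx hxv
    by_contra hcon
    push Not at hcon
    exact hxv (aux_unique G 𝒯 h T₁ (Finset.mem_insert_of_mem hT₁) x v₁ hx hv₁T hcon hv₁top)
  have hσsub : ∀ x ∈ σT₁, x ≠ vσ → ∃ S ∈ 𝒯, S ⊂ σT₁ ∧ x ∈ S := by
    intro x hx hxv
    by_contra hcon
    push Not at hcon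
    exact hxv (aux_unique G 𝒯 h σT₁ hσ x vσ hx hvσσ hcon hvσtop)
  have hnv : T₁ ∉ 𝒯' := by
    intro hh
    exact (hfrom' T₁ hh hne).2 rfl
  have htop' : ∀ S ∈ 𝒯', S ⊂ σT₁ → v₁ ∉ S := by
    obtain ⟨x, hxσ, hxtop⟩ := aux_top G hG 𝒯' h'.1 σT₁ hσ'
    by_cases hxv : x = vσ
    · exfalso
      subst hxv
      obtain ⟨C, hC1, hC2, hC3, hC4⟩ := aux_comp G σT₁ v₁ x hv₁σ hvσσ hne_v
      have hC𝒯 := hC4 𝒯 h hσ hvσtop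
      have hC𝒯' := hC4 𝒯' h' hσ' hxtop
      have : C = T₁ := by
        by_contra hn
        exact hC2.2 (hb1 C (Finset.mem_insert_of_mem hC𝒯) hn hC1)
      exact hnv (this ▸ hC𝒯')
    · obtain ⟨S, hS, hSσ, hxS⟩ := hσsub x hxσ hxv
      have hST : S = T₁ := by
        by_contra hn
        exact hxtop S (hto' S hS hn) hSσ hxS
      subst hST
      have : x = v₁ := by
        by_contra hn
        obtain ⟨S', hS', hS'T, hxS'⟩ := hT₁sub x hxS hn
        exact hxtop S' (hto' S' hS' hS'T.ne) (hS'T.trans hTσ) hxS'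
      exact this ▸ hxtop
  have hv₁T' : v₁ ∉ T₁' := htop' T₁' hT₁' hT'σ
  have hvσT' : vσ ∈ T₁' := by
    by_contra hcon
    apply hne_v
    apply aux_unique G 𝒯' h' σT₁ hσ' v₁ vσ hv₁σ hvσσ htop'
    intro S hS hSσ hv
    have hn : S ≠ T₁' := fun hh => hcon (hh ▸ hv)
    obtain ⟨hS1, hS2⟩ := hfrom' S hS hn
    exact hSσ.2 (hb2 S (Finset.mem_insert_of_mem hS1) hv)
  have hcover : T₁ ∪ T₁' = σT₁ := by
    apply Finset.Subset.antisymm (Finset.union_subset hTσ.1 hT'σ.1)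
    intro x hx
    by_contra hcon
    rw [Finset.mem_union, not_or] at hcon
    obtain ⟨hxT, hxT'⟩ := hcon
    obtain ⟨S0, hS0, hS0σ, hxS0⟩ := hσsub x hx (fun hh => hxT' (hh ▸ hvσT'))
    obtain ⟨S, hS, hmax⟩ := Finset.exists_max_image (𝒯.filter (fun S => S ⊂ σT₁ ∧ x ∈ S))
      Finset.card ⟨S0, by simp [hS0, hS0σ, hxS0]⟩
    rw [Finset.mem_filter] at hS
    obtain ⟨hS, hSσ, hxS⟩ := hS
    have hST : S ≠ T₁ := fun hh => hxT (hh ▸ hxS)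
    obtain ⟨a, haS, y, hyσ, hyS, hay⟩ :=
      aux_edge G σT₁ S (aux_conn G hG 𝒯 h.1 σT₁ hσ) ⟨x, hxS⟩ hSσ
    by_cases hyv : y = vσ
    · subst hyv
      rcases aux_compat G 𝒯' h'.1 S T₁' (Finset.mem_insert_of_mem (hto' S hS hST))
        (Finset.mem_insert_of_mem hT₁') with h1 | h1 | h1 | h1
      · exact hxT' (h1 ▸ hxS)
      · exact hxT' (h1.1 hxS)
      · exact hyS (h1.1 hvσT')
      · exact h1.2 a haS y hvσT' hay
    · obtain ⟨S', hS', hS'σ, hyS'⟩ := hσsub y hyσ hyv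
      rcases aux_compat G 𝒯 h.1 S S' (Finset.mem_insert_of_mem hS)
        (Finset.mem_insert_of_mem hS') with h1 | h1 | h1 | h1
      · exact hyS (h1 ▸ hyS')
      · have := hmax S' (by simp [hS', hS'σ, h1.1 hxS])
        have := Finset.card_lt_card h1
        omega
      · exact hyS (h1.1 hyS')
      · exact h1.2 a haS y hyS' hay
  have hs := aux_sum G hG 𝒯 h.1 w hw
  have hs' := aux_sum G hG 𝒯' h'.1 w' hw'
  have hindic : ∀ (S : Finset V) (a : V), ∑ u ∈ S, indic a u = if a ∈ S then 1 else 0 := by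
    intro S a
    simp [indic]
  set m : ℤ := w' v₁ - w v₁ with hm
  have hg : ∀ n : ℕ, ∀ S ∈ insert Finset.univ 𝒯, S ≠ T₁ → S.card ≤ n → ∀ u ∈ S,
      w' u - w u - m * (indic v₁ u - indic vσ u) = 0 := by
    intro n
    induction n with
    | zero =>
      intro S _ _ hc u hu
      rw [Finset.card_eq_zero.1 (Nat.le_zero.1 hc)] at hu
      simp at hu
    | succ n ih =>
      intro S hS hST hc u hu
      by_contra hne0
      have hiff : v₁ ∈ S ↔ vσ ∈ S :=
        ⟨fun hh => hb1 S hS hST hh hvσσ, fun hh => hb2 S hS hh hv₁σ⟩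
      have hsum : ∑ x ∈ S, (w' x - w x - m * (indic v₁ x - indic vσ x)) = 0 := by
        rw [Finset.sum_sub_distrib, Finset.sum_sub_distrib, ← Finset.mul_sum,
          Finset.sum_sub_distrib, hindic, hindic, hs S hS, hs' S (hto'u S hS hST)]
        simp [hiff]
      have htopof : ∀ x ∈ S, w' x - w x - m * (indic v₁ x - indic vσ x) ≠ 0 →
          ∀ S' ∈ 𝒯, S' ⊂ S → x ∉ S' := by
        intro x hx hx0 S' hS' hS'S hxS'
        have hnT : ∀ R ∈ 𝒯, R ≠ T₁ → R ⊂ S → x ∉ R := by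
          intro R hR hRT hRS hxR
          have := Finset.card_lt_card hRS
          exact hx0 (ih R (Finset.mem_insert_of_mem hR) hRT (by omega) x hxR)
        have hS'T : S' = T₁ := by
          by_contra hn
          exact hnT S' hS' hn hS'S hxS'
        subst hS'T
        have hxv : x ≠ v₁ := by
          rintro rfl
          apply hx0
          simp [indic, hne_v, hm]
        obtain ⟨R, hR, hRT, hxR⟩ := hT₁sub x hxS' hxv
        exact hnT R hR hRT.ne (hRT.trans hS'S) hxR
      rw [Finset.sum_eq_single u] at hsum
      · exact hne0 hsum
      · intro x hx hxu
        by_contra hx0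
        exact hxu (aux_unique G 𝒯 h S hS x u hx hu (htopof x hx hx0) (htopof u hu hne0))
      · intro hh
        exact absurd hu hh
  have hd : ∀ u : V, w' u - w u = m * (indic v₁ u - indic vσ u) := by
    intro u
    have hu : T₁ ≠ Finset.univ := (h.1.1 T₁ hT₁).2.1
    have := hg _ Finset.univ (Finset.mem_insert_self _ _) hu.symm le_rfl u (Finset.mem_univ u)
    linarith
  refine ⟨m, ?_, hd⟩
  have e1 : ∑ x ∈ T₁, w' x = wtf T₁.card + m := by
    have : ∑ x ∈ T₁, (w' x - w x) = m := by
      rw [Finset.sum_congr rfl (fun x _ => hd x), ← Finset.mul_sum, Finset.sum_sub_distrib,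
        hindic, hindic]
      simp [hv₁T, hvσT₁]
    rw [Finset.sum_sub_distrib, hs T₁ (Finset.mem_insert_of_mem hT₁)] at this
    linarith
  have e2 := hs' T₁' (Finset.mem_insert_of_mem hT₁')
  have e3 := hs' σT₁ hσ'
  have e4 : ∑ x ∈ T₁ ∪ T₁', w' x + ∑ x ∈ T₁ ∩ T₁', w' x = _ :=
    Finset.sum_union_inter (s₁ := T₁) (s₂ := T₁') (f := w')
  rw [hcover] at e4
  have e5 : 0 ≤ ∑ x ∈ T₁ ∩ T₁', w' x := by
    apply aux_nonneg G hG 𝒯' h'.1 w' hw' _ _ le_rfl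
    intro x hx
    rw [Finset.mem_inter] at hx
    obtain ⟨S, hS, hST, hxS⟩ := hT₁sub x hx.1 (fun hh => hv₁T' (hh ▸ hx.2))
    have hS' := hto' S hS hST.ne
    refine ⟨S, hS', hxS, Finset.subset_inter hST.1 ?_⟩
    rcases aux_compat G 𝒯' h'.1 S T₁' (Finset.mem_insert_of_mem hS')
        (Finset.mem_insert_of_mem hT₁') with h1 | h1 | h1 | h1
    · exact h1.subset
    · exact h1.1
    · exact absurd (hST.1 (h1.1 hvσT')) hvσT₁
    · exact absurd hx.2 (h1.1 x hxS)
  have l1 := Finset.card_lt_card hTσ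
  have l2 := Finset.card_lt_card hT'σ
  have l0 : 0 < T₁.card := Finset.card_pos.2 ⟨v₁, hv₁T⟩
  have e6 := wtf_lt T₁.card T₁'.card σT₁.card l1 l2 (by omega)
  linarith
end
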